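/- Let p ∈ [0, n), K > 0, L > 0, and let Ω ⊂ ℝⁿ (n ≥ 2) be a bounded open convex set. Let u, v be continuous on the closure of Ω and twice continuously differentiable in Ω, and assume: (a) v is convex in Ω, v < 0 in Ω, v ≤ 0 on ∂Ω, and det D²v(x) ≥ K·|v(x)|^p for all x ∈ Ω; (b) u ≥ 0 on ∂Ω and det D²u(x) ≤ L·|u(x)|^p for all x ∈ Ω. Then −u(x) ≤ (K/L)^{1/(p−n)} · |v(x)| for all x ∈ Ω. -/

import Mathlib

open Metric MeasureTheory Real

/-- The Hessian matrix of `u : ℝⁿ → ℝ` at `x`, with entries the second partial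
derivatives `∂²u/∂xᵢ∂xⱼ` computed via iterated Fréchet derivatives. -/
noncomputable def hessianMatrix {n : ℕ} (u : EuclideanSpace ℝ (Fin n) → ℝ)
    (x : EuclideanSpace ℝ (Fin n)) : Matrix (Fin n) (Fin n) ℝ :=
  Matrix.of fun i j =>
    fderiv ℝ (fun y => fderiv ℝ u y (EuclideanSpace.single j 1)) x (EuclideanSpace.single i 1)

/-- The determinant of the Hessian matrix, `det D²u(x)`. -/
noncomputable def hessianDet {n : ℕ} (u : EuclideanSpace ℝ (Fin n) → ℝ)
    (x : EuclideanSpace ℝ (Fin n)) : ℝ := (hessianMatrix u x).det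

open Filter Topology Matrix

open scoped MatrixOrder in
/-- The determinant is monotone on positive semidefinite matrices for the Loewner order. -/
lemma Matrix.PosSemidef.det_le_det_of_sub {m : Type*} [Fintype m] [DecidableEq m]
    {A B : Matrix m m ℝ} (hB : B.PosSemidef) (hAB : (A - B).PosSemidef) : B.det ≤ A.det := by
  have one_le : ∀ D : Matrix m m ℝ, D.PosSemidef → 1 ≤ (1 + D).det := by
    intro D hD
    have hH : (1 + D).IsHermitian := isHermitian_one.add hD.isHermitian
    rw [hH.det_eq_prod_eigenvalues]
    refine Finset.one_le_prod fun i _ => ?_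
    have hnorm : star (⇑(hH.eigenvectorBasis i) : m → ℝ) ⬝ᵥ ⇑(hH.eigenvectorBasis i) = 1 := by
      have h := hH.eigenvectorBasis.orthonormal.1 i
      have h2 := real_inner_self_eq_norm_sq (hH.eigenvectorBasis i)
      rw [h, EuclideanSpace.inner_eq_star_dotProduct, dotProduct_comm] at h2
      simpa using h2
    have hpos := hD.dotProduct_mulVec_nonneg (⇑(hH.eigenvectorBasis i))
    have heq := hH.eigenvalues_eq i
    rw [add_mulVec, one_mulVec, dotProduct_add, hnorm] at heq
    simp only [RCLike.re_to_real] at heq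
    rw [RCLike.ofReal_real_eq_id, id, heq]
    exact le_add_of_nonneg_right hpos
  have hA : A.PosSemidef := by simpa using hAB.add hB
  by_cases hdet : B.det = 0
  · rw [hdet]
    exact hA.det_nonneg
  obtain ⟨S, rfl⟩ := CStarAlgebra.nonneg_iff_eq_star_mul_self.mp hB.nonneg
  rw [star_eq_conjTranspose] at *
  have hS : IsUnit S.det := by
    rw [isUnit_iff_ne_zero]
    intro h
    exact hdet (by rw [det_mul, h, mul_zero])
  have hSH : IsUnit Sᴴ.det := by simpa [det_conjTranspose] using hS
  have hconj := hAB.conjTranspose_mul_mul_same S⁻¹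
  have hfac : A = Sᴴ * (1 + (S⁻¹)ᴴ * (A - Sᴴ * S) * S⁻¹) * S := by
    rw [conjTranspose_nonsing_inv]
    simp only [mul_add, add_mul, mul_one, Matrix.mul_assoc, nonsing_inv_mul S hS]
    rw [← Matrix.mul_assoc Sᴴ, mul_nonsing_inv _ hSH, Matrix.one_mul]
    abel
  have hfactor : A.det = (Sᴴ * S).det * (1 + (S⁻¹)ᴴ * (A - Sᴴ * S) * S⁻¹).det := by
    conv_lhs => rw [hfac]
    simp only [det_mul]
    ring
  rw [hfactor]
  exact le_mul_of_one_le_right hB.det_nonneg (one_le _ hconj)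

/-- The second-order necessary condition at a local minimum. -/
lemma IsLocalMin.second_deriv_nonneg {f f' : ℝ → ℝ} {a c : ℝ} (hmin : IsLocalMin f a)
    (hf : ∀ᶠ t in 𝓝 a, HasDerivAt f (f' t) t) (hf' : HasDerivAt f' c a) : 0 ≤ c := by
  by_contra! hc
  have h0 : f' a = 0 := hmin.hasDerivAt_eq_zero hf.self_of_nhds
  set g : ℝ → ℝ := fun t => f t - c / 4 * (t - a) ^ 2 with hg
  have hder : ∀ᶠ t in 𝓝 a, HasDerivAt g (f' t - c / 2 * (t - a)) t := by
    filter_upwards [hf] with t ht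
    have hsq := ((((hasDerivAt_id' t).sub_const a).pow 2).const_mul (c / 4))
    exact (ht.sub hsq).congr_deriv (by push_cast; ring)
  have hderiv : deriv g =ᶠ[𝓝 a] fun t => f' t - c / 2 * (t - a) := by
    filter_upwards [hder] with t ht using ht.deriv
  have hsecond : deriv (deriv g) a = c / 2 := by
    rw [hderiv.deriv_eq]
    have hlin := ((hasDerivAt_id' a).sub_const a).const_mul (c / 2)
    exact (hf'.fun_sub hlin).deriv.trans (by ring)
  have hmax : IsLocalMax g a := by
    refine isLocalMax_of_deriv_deriv_neg (by rw [hsecond]; linarith) ?_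
      hder.self_of_nhds.continuousAt
    rw [hderiv.eq_of_nhds, h0]
    ring
  have hev : ∀ᶠ t in 𝓝[≠] a, g t ≤ g a ∧ f a ≤ f t ∧ t ≠ a := by
    filter_upwards [hmax.filter_mono nhdsWithin_le_nhds, hmin.filter_mono nhdsWithin_le_nhds,
      self_mem_nhdsWithin] with t h1 h2 h3 using ⟨h1, h2, h3⟩
  obtain ⟨t, h1, h2, h3⟩ := hev.exists
  have hsq : 0 < (t - a) ^ 2 := by
    have := sub_ne_zero.mpr h3
    positivity
  simp only [hg, sub_self] at h1
  nlinarith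

section Line

variable {E : Type*} [NormedAddCommGroup E] [NormedSpace ℝ E] {u : E → ℝ} {x : E}

lemma ContDiffAt.eventually_hasDerivAt_line (hu : ContDiffAt ℝ 2 u x) (e : E) :
    ∀ᶠ t in 𝓝 (0 : ℝ),
      HasDerivAt (fun s : ℝ => u (x + s • e)) (fderiv ℝ u (x + t • e) e) t := by
  have htend : Tendsto (fun t : ℝ => x + t • e) (𝓝 0) (𝓝 x) := by
    have : Continuous fun t : ℝ => x + t • e := by fun_prop
    simpa using this.tendsto 0
  filter_upwards [htend.eventually (hu.eventually (by simp))] with t ht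
  have hline : HasDerivAt (fun s : ℝ => x + s • e) e t := by
    simpa using ((hasDerivAt_id t).smul_const e).const_add x
  exact (ht.differentiableAt (by simp)).hasFDerivAt.comp_hasDerivAt t hline

lemma ContDiffAt.hasDerivAt_fderiv_line (hu : ContDiffAt ℝ 2 u x) (e : E) :
    HasDerivAt (fun s : ℝ => fderiv ℝ u (x + s • e) e) (fderiv ℝ (fderiv ℝ u) x e e) 0 := by
  have hd : DifferentiableAt ℝ (fderiv ℝ u) x :=
    (hu.fderiv_right (m := 1) (by norm_num)).differentiableAt (by simp)
  have hline : HasDerivAt (fun s : ℝ => x + s • e) e 0 := by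
    simpa using ((hasDerivAt_id (0 : ℝ)).smul_const e).const_add x
  have hd' : HasFDerivAt (fderiv ℝ u) (fderiv ℝ (fderiv ℝ u) x) (x + (0 : ℝ) • e) := by
    simpa using hd.hasFDerivAt
  have hcomp := hd'.comp_hasDerivAt (0 : ℝ) hline
  simpa using hcomp.clm_apply (hasDerivAt_const (0 : ℝ) e)

lemma ConvexOn.second_fderiv_nonneg {s : Set E} (hs : IsOpen s) (hconv : ConvexOn ℝ s u)
    (hx : x ∈ s) (hu : ContDiffAt ℝ 2 u x) (e : E) : 0 ≤ fderiv ℝ (fderiv ℝ u) x e e := by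
  have hmem : ∀ d : E, ∀ᶠ t in 𝓝 (0 : ℝ), x + t • d ∈ s := by
    intro d
    have hc : Continuous fun t : ℝ => x + t • d := by fun_prop
    exact hc.continuousAt.eventually (hs.mem_nhds (by simpa using hx))
  have hmin : IsLocalMin (fun t : ℝ => u (x + t • e) + u (x + t • (-e))) 0 := by
    filter_upwards [hmem e, hmem (-e)] with t h1 h2
    have h := hconv.2 h1 h2 (by norm_num : (0 : ℝ) ≤ 1 / 2) (by norm_num : (0 : ℝ) ≤ 1 / 2) (by norm_num)
    have hmid : (1 / 2 : ℝ) • (x + t • e) + (1 / 2 : ℝ) • (x + t • (-e)) = x := by module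
    rw [hmid] at h
    simp only [smul_eq_mul, zero_smul, add_zero] at h ⊢
    linarith
  have hder := hmin.second_deriv_nonneg
    ((hu.eventually_hasDerivAt_line e).and (hu.eventually_hasDerivAt_line (-e)) |>.mono
      fun t ht => ht.1.add ht.2)
    ((hu.hasDerivAt_fderiv_line e).add (hu.hasDerivAt_fderiv_line (-e)))
  simp only [map_neg, _root_.neg_apply, neg_neg] at hder
  linarith

end Line

section Hessian

variable {n : ℕ} {u : EuclideanSpace ℝ (Fin n) → ℝ} {x : EuclideanSpace ℝ (Fin n)}

lemma hessianMatrix_apply (hu : ContDiffAt ℝ 2 u x) (i j : Fin n) :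
    hessianMatrix u x i j = fderiv ℝ (fderiv ℝ u) x (EuclideanSpace.single i 1)
      (EuclideanSpace.single j 1) := by
  have hd : DifferentiableAt ℝ (fderiv ℝ u) x :=
    (hu.fderiv_right (m := 1) (by norm_num)).differentiableAt (by simp)
  simp [hessianMatrix, fderiv_clm_apply hd (differentiableAt_const _)]

lemma hessianMatrix_isHermitian (hu : ContDiffAt ℝ 2 u x) : (hessianMatrix u x).IsHermitian := by
  ext i j
  rw [conjTranspose_apply, star_trivial, hessianMatrix_apply hu, hessianMatrix_apply hu]
  exact hu.isSymmSndFDerivAt (by simp) _ _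

lemma dotProduct_hessianMatrix_mulVec (hu : ContDiffAt ℝ 2 u x) (a : Fin n → ℝ) :
    a ⬝ᵥ (hessianMatrix u x *ᵥ a) =
      fderiv ℝ (fderiv ℝ u) x (WithLp.toLp 2 a) (WithLp.toLp 2 a) := by
  have ha : WithLp.toLp 2 a = ∑ i, a i • EuclideanSpace.single i (1 : ℝ) := by
    ext j
    simp [Finset.sum_apply, Pi.single_apply]
  rw [ha]
  simp only [map_sum, map_smul, _root_.sum_apply, _root_.smul_apply,
    dotProduct, mulVec, smul_eq_mul, hessianMatrix_apply hu, Finset.mul_sum]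
  rw [Finset.sum_comm]
  refine Finset.sum_congr rfl fun i _ => Finset.sum_congr rfl fun j _ => ?_
  ring

lemma ConvexOn.hessianMatrix_posSemidef {s : Set (EuclideanSpace ℝ (Fin n))} (hs : IsOpen s)
    (hconv : ConvexOn ℝ s u) (hx : x ∈ s) (hu : ContDiffAt ℝ 2 u x) :
    (hessianMatrix u x).PosSemidef := by
  refine .of_dotProduct_mulVec_nonneg (hessianMatrix_isHermitian hu) fun a => ?_
  rw [star_trivial, dotProduct_hessianMatrix_mulVec hu]
  exact hconv.second_fderiv_nonneg hs hx hu _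

/-- If `z ↦ u (x + z) - M * v (y + l • z)` has a local minimum at `0`, then the Hessian of `u`
at `x` dominates `M * l ^ 2` times the Hessian of `v` at `y`. -/
lemma hessianMatrix_sub_smul_posSemidef {v : EuclideanSpace ℝ (Fin n) → ℝ}
    {y : EuclideanSpace ℝ (Fin n)} {M l : ℝ} (hu : ContDiffAt ℝ 2 u x) (hv : ContDiffAt ℝ 2 v y)
    (hmin : IsLocalMin (fun z => u (x + z) - M * v (y + l • z)) 0) :
    (hessianMatrix u x - (M * l ^ 2) • hessianMatrix v y).PosSemidef := by
  refine .of_dotProduct_mulVec_nonneg ((hessianMatrix_isHermitian hu).sub ?_) fun a => ?_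
  · exact (hessianMatrix_isHermitian hv).smul (IsSelfAdjoint.all _)
  rw [star_trivial, sub_mulVec, smul_mulVec, dotProduct_sub, dotProduct_smul,
    dotProduct_hessianMatrix_mulVec hu, dotProduct_hessianMatrix_mulVec hv]
  set e := WithLp.toLp 2 a
  have hline : IsLocalMin (fun t : ℝ => u (x + t • e) - M * v (y + t • (l • e))) 0 := by
    have hc : Continuous fun t : ℝ => t • e := by fun_prop
    have htend : Tendsto (fun t : ℝ => t • e) (𝓝 0) (𝓝 0) := by simpa using hc.tendsto 0
    filter_upwards [htend.eventually hmin] with t ht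
    simpa [smul_comm l t e] using ht
  have hder := hline.second_deriv_nonneg
    ((hu.eventually_hasDerivAt_line e).and (hv.eventually_hasDerivAt_line (l • e)) |>.mono
      fun t ht => ht.1.sub (ht.2.const_mul M))
    ((hu.hasDerivAt_fderiv_line e).sub ((hv.hasDerivAt_fderiv_line (l • e)).const_mul M))
  simp only [map_smul, _root_.smul_apply, smul_eq_mul] at hder ⊢
  linarith

end Hessian

/-- Scaled comparison principle for `det D²v ≥ K|v|^p` and
`det D²u ≤ L|u|^p` with `0 ≤ p < n`: one has `-u ≤ (K/L)^{1/(p-n)} |v|`. -/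
theorem stmt_6 (n : ℕ) (hn : 2 ≤ n) (p K L : ℝ)
    (hp0 : 0 ≤ p) (hpn : p < (n : ℝ)) (hK : 0 < K) (hL : 0 < L)
    (Ω : Set (EuclideanSpace ℝ (Fin n)))
    (hΩo : IsOpen Ω) (hΩb : Bornology.IsBounded Ω) (hΩc : Convex ℝ Ω)
    (u v : EuclideanSpace ℝ (Fin n) → ℝ)
    (hu_cont : ContinuousOn u (closure Ω)) (hu2 : ContDiffOn ℝ 2 u Ω)
    (hv_cont : ContinuousOn v (closure Ω)) (hv2 : ContDiffOn ℝ 2 v Ω)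
    (hvconv : ConvexOn ℝ Ω v)
    (hvneg : ∀ x ∈ Ω, v x < 0)
    (hvbd : ∀ x ∈ frontier Ω, v x ≤ 0)
    (hvsub : ∀ x ∈ Ω, hessianDet v x ≥ K * |v x| ^ p)
    (hubd : ∀ x ∈ frontier Ω, 0 ≤ u x)
    (husup : ∀ x ∈ Ω, hessianDet u x ≤ L * |u x| ^ p) :
    ∀ x ∈ Ω, -u x ≤ (K / L) ^ (1 / (p - (n : ℝ))) * |v x| := by
  intro x₀ hx₀
  by_contra! hcon
  set α : ℝ := (K / L) ^ (1 / (p - (n : ℝ))) with hα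
  have hα0 : 0 < α := by positivity
  have hnp : 0 < (n : ℝ) - p := sub_pos.mpr hpn
  have hαpow : α ^ ((n : ℝ) - p) * K = L := by
    have hexp : 1 / (p - (n : ℝ)) * ((n : ℝ) - p) = -1 := by
      have : p - (n : ℝ) ≠ 0 := by linarith
      field_simp
      ring
    rw [hα, ← Real.rpow_mul (by positivity), hexp, Real.rpow_neg_one]
    field_simp
  set r : ℝ := u x₀ / v x₀ with hr
  have hv₀ := hvneg x₀ hx₀
  have hαr : α < r := by
    rw [hr, lt_div_iff_of_neg hv₀]
    rw [abs_of_neg hv₀] at hcon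
    linarith
  have hr0 : 0 < r := hα0.trans hαr
  have hrpow : L < r ^ ((n : ℝ) - p) * K := by
    rw [← hαpow]
    gcongr
  obtain ⟨l, hl, hl0, hl1⟩ : ∃ l : ℝ,
      L < (l ^ 2) ^ n * (r ^ ((n : ℝ) - p) * K) ∧ 0 < l ∧ l < 1 := by
    have hc : Continuous fun l : ℝ => (l ^ 2) ^ n * (r ^ ((n : ℝ) - p) * K) := by fun_prop
    have hev : ∀ᶠ l in 𝓝 (1 : ℝ), L < (l ^ 2) ^ n * (r ^ ((n : ℝ) - p) * K) :=
      hc.continuousAt.eventually (lt_mem_nhds (by simpa using hrpow))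
    have hev' : ∀ᶠ l in 𝓝[<] (1 : ℝ),
        L < (l ^ 2) ^ n * (r ^ ((n : ℝ) - p) * K) ∧ 0 < l ∧ l < 1 := by
      filter_upwards [hev.filter_mono nhdsWithin_le_nhds,
        (lt_mem_nhds (zero_lt_one' ℝ)).filter_mono nhdsWithin_le_nhds, self_mem_nhdsWithin]
        with l h1 h2 h3 using ⟨h1, h2, h3⟩
    exact hev'.exists
  set T : EuclideanSpace ℝ (Fin n) → EuclideanSpace ℝ (Fin n) :=
    fun x => (1 - l) • x₀ + l • x with hT
  have hTcont : Continuous T := by fun_prop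
  have hTmem : ∀ x ∈ closure Ω, T x ∈ Ω := by
    intro x hx
    have h := hΩc.combo_interior_closure_mem_interior (by rwa [hΩo.interior_eq]) hx
      (sub_pos.mpr hl1) hl0.le (by ring)
    rwa [hΩo.interior_eq] at h
  have hT₀ : T x₀ = x₀ := by
    simp only [hT]
    module
  have hTadd : ∀ x z, T (x + z) = T x + l • z := by
    intro x z
    simp only [hT]
    module
  have hcont : ContinuousOn (fun x => u x / v (T x)) (closure Ω) := by
    refine hu_cont.div (hv_cont.comp hTcont.continuousOn fun x hx => subset_closure (hTmem x hx)) ?_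
    exact fun x hx => (hvneg _ (hTmem x hx)).ne
  obtain ⟨x₁, hx₁, hmax⟩ := hΩb.isCompact_closure.exists_isMaxOn ⟨x₀, subset_closure hx₀⟩ hcont
  set M : ℝ := u x₁ / v (T x₁) with hM
  have hrM : r ≤ M := by
    have h := hmax (subset_closure hx₀)
    simpa only [Set.mem_ofPred_eq, hT₀] using h
  have hM0 : 0 < M := hr0.trans_le hrM
  have hv₁ := hvneg _ (hTmem x₁ hx₁)
  have hu₁ : u x₁ = M * v (T x₁) := by rw [hM, div_mul_cancel₀ _ hv₁.ne]
  have hx₁Ω : x₁ ∈ Ω := by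
    by_contra hnot
    have h := hubd x₁ (by rw [hΩo.frontier_eq]; exact ⟨hx₁, hnot⟩)
    have := mul_neg_of_pos_of_neg hM0 hv₁
    linarith
  have hu2₁ : ContDiffAt ℝ 2 u x₁ := hu2.contDiffAt (hΩo.mem_nhds hx₁Ω)
  have hv2₁ : ContDiffAt ℝ 2 v (T x₁) := hv2.contDiffAt (hΩo.mem_nhds (hTmem x₁ hx₁))
  have hmin : IsLocalMin (fun z => u (x₁ + z) - M * v (T x₁ + l • z)) 0 := by
    have hc : Continuous fun z : EuclideanSpace ℝ (Fin n) => x₁ + z := by fun_prop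
    have hev : ∀ᶠ z in 𝓝 (0 : EuclideanSpace ℝ (Fin n)), x₁ + z ∈ Ω :=
      hc.continuousAt.eventually (hΩo.mem_nhds (by simpa using hx₁Ω))
    filter_upwards [hev] with z hz
    have hle : u (x₁ + z) / v (T (x₁ + z)) ≤ M := hmax (subset_closure hz)
    rw [div_le_iff_of_neg (hvneg _ (hTmem _ (subset_closure hz))), hTadd] at hle
    simp only [add_zero, smul_zero, hu₁, sub_self]
    linarith
  have hB := hvconv.hessianMatrix_posSemidef hΩo (hTmem x₁ hx₁) hv2₁
  have hdet := (hB.smul (by positivity : 0 ≤ M * l ^ 2)).det_le_det_of_sub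
    (hessianMatrix_sub_smul_posSemidef hu2₁ hv2₁ hmin)
  rw [det_smul, Fintype.card_fin] at hdet
  have hsup := husup x₁ hx₁Ω
  have hsub := hvsub _ (hTmem x₁ hx₁)
  rw [hu₁, abs_mul, abs_of_pos hM0, Real.mul_rpow hM0.le (abs_nonneg _)] at hsup
  have hvp : 0 < |v (T x₁)| ^ p := Real.rpow_pos_of_pos (abs_pos.mpr hv₁.ne) p
  have hMp : 0 < M ^ p := Real.rpow_pos_of_pos hM0 p
  have hMn : M ^ n = M ^ ((n : ℝ) - p) * M ^ p := by
    rw [← Real.rpow_add hM0, sub_add_cancel, Real.rpow_natCast]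
  have hchain : (M * l ^ 2) ^ n * (K * |v (T x₁)| ^ p) ≤ L * (M ^ p * |v (T x₁)| ^ p) :=
    (mul_le_mul_of_nonneg_left hsub (by positivity)).trans (hdet.trans hsup)
  have hfinal : (l ^ 2) ^ n * (M ^ ((n : ℝ) - p) * K) ≤ L := by
    refine le_of_mul_le_mul_right ?_ (mul_pos hMp hvp)
    rw [mul_pow, hMn] at hchain
    linarith
  have hmono : (l ^ 2) ^ n * (r ^ ((n : ℝ) - p) * K) ≤ (l ^ 2) ^ n * (M ^ ((n : ℝ) - p) * K) := by
    gcongr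
  linarith
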